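/- Let R : ℝ² → ℝ² be the rotation about the origin by 120°, and let P ∈ ℝ² satisfy 1 < ‖RP − P‖ < 3. Then the trihex with pinned equilateral triangle P, RP, R²P and all twelve bars of unit length is flexible: there exists a nonconstant continuous map t ↦ (x₁(t), …, x₆(t)) from [0,1] into (ℝ²)⁶ such that for every t all twelve bars of the trihex (with inner vertices x₁(t), …, x₆(t)) have unit length. In particular this framework has uncountably many realizations. -/

import Mathlib

noncomputable section

/-- The Euclidean plane ℝ². -/
abbrev Plane := EuclideanSpace ℝ (Fin 2)

/-- The rotation of the plane about the origin by 120°. -/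
noncomputable def rot120 (v : Plane) : Plane :=
  (WithLp.equiv 2 (Fin 2 → ℝ)).symm
    ![-(v 0) / 2 - Real.sqrt 3 / 2 * v 1, Real.sqrt 3 / 2 * v 0 - v 1 / 2]

/-- A realization of the trihex with pinned equilateral triangle `P, R P, R²P`
(`R` = rotation by 120°) and all twelve bars of unit length: `x 0, …, x 5` are the six
inner hexagon vertices `x₁, …, x₆`, the nine path edges `{P,x₁}, {x₁,x₂}, {x₂,RP},
{RP,x₃}, {x₃,x₄}, {x₄,R²P}, {R²P,x₅}, {x₅,x₆}, {x₆,P}` and the three hexagon edges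
`{x₂,x₃}, {x₄,x₅}, {x₆,x₁}` all have unit length. -/
def TrihexRealization (P : Plane) (x : Fin 6 → Plane) : Prop :=
  ‖x 0 - P‖ = 1 ∧ ‖x 1 - x 0‖ = 1 ∧ ‖rot120 P - x 1‖ = 1 ∧
  ‖x 2 - rot120 P‖ = 1 ∧ ‖x 3 - x 2‖ = 1 ∧ ‖rot120 (rot120 P) - x 3‖ = 1 ∧
  ‖x 4 - rot120 (rot120 P)‖ = 1 ∧ ‖x 5 - x 4‖ = 1 ∧ ‖P - x 5‖ = 1 ∧
  ‖x 2 - x 1‖ = 1 ∧ ‖x 4 - x 3‖ = 1 ∧ ‖x 0 - x 5‖ = 1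

theorem rot120_sub (v w : Plane) : rot120 (v - w) = rot120 v - rot120 w := by
  ext i
  fin_cases i <;> simp [rot120] <;> ring

theorem rot120_neg (v : Plane) : rot120 (-v) = -rot120 v := by
  ext i
  fin_cases i <;> simp [rot120] <;> ring

theorem rot120_rot120 (v : Plane) : rot120 (rot120 v) = -v - rot120 v := by
  have h : √3 * √3 = 3 := Real.mul_self_sqrt (by norm_num)
  ext i
  fin_cases i <;> simp [rot120]
  · linear_combination (-(v 0) / 4) * h
  · linear_combination (-(v 1) / 4) * h

theorem norm_rot120 (v : Plane) : ‖rot120 v‖ = ‖v‖ := by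
  have h : √3 * √3 = 3 := Real.mul_self_sqrt (by norm_num)
  rw [← sq_eq_sq₀ (norm_nonneg _) (norm_nonneg _), EuclideanSpace.real_norm_sq_eq,
    EuclideanSpace.real_norm_sq_eq]
  simp [rot120, Fin.sum_univ_two]
  linear_combination ((v 0 ^ 2 + v 1 ^ 2) / 4) * h

@[fun_prop]
theorem continuous_rot120 : Continuous rot120 := by
  refine (PiLp.continuous_toLp 2 _).comp (continuous_pi fun i => ?_)
  fin_cases i <;> simp <;> fun_prop

/-- The rotation of the plane about the origin by 90°. -/
def rot90 (v : Plane) : Plane := !₂[-v 1, v 0]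

@[fun_prop]
theorem continuous_rot90 : Continuous rot90 := by
  refine (PiLp.continuous_toLp 2 _).comp (continuous_pi fun i => ?_)
  fin_cases i <;> simp <;> fun_prop

theorem norm_sq_smul_add_smul_rot90 (x y : ℝ) (v : Plane) :
    ‖x • v + y • rot90 v‖ ^ 2 = (x ^ 2 + y ^ 2) * ‖v‖ ^ 2 := by
  simp [EuclideanSpace.real_norm_sq_eq, Fin.sum_univ_two, rot90]
  ring

/-- The hexagon built from three vectors `a`, `b`, `c` at the corners `P`, `R P`, `R² P`. -/
def trihexOfVectors (P a b c : Plane) : Fin 6 → Plane :=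
  ![P + a, rot120 P - b, rot120 P + rot120 b, rot120 (rot120 P) - rot120 c,
    rot120 (rot120 P) + rot120 (rot120 c), P - rot120 (rot120 a)]

theorem trihexRealization_trihexOfVectors {P a b c : Plane} (ha : ‖a‖ = 1) (hb : ‖b‖ = 1)
    (hc : ‖c‖ = 1) (h : a + b + c = rot120 P - P) :
    TrihexRealization P (trihexOfVectors P a b c) := by
  obtain rfl : c = rot120 P - P - a - b := by rw [← h]; abel
  simp only [TrihexRealization, trihexOfVectors, Matrix.cons_val]
  refine ⟨?_, ?_, ?_, ?_, ?_, ?_, ?_, ?_, ?_, ?_, ?_, ?_⟩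
  · rw [← ha]; congr 1; abel
  · rw [← hc]; congr 1; abel
  · rw [← hb]; congr 1; abel
  · rw [← hb, ← norm_rot120 b]; congr 1; abel
  · rw [← ha, ← norm_rot120 a]; congr 1; simp only [rot120_sub]; abel
  · rw [← hc, ← norm_rot120 (rot120 P - P - a - b)]; congr 1; abel
  · rw [← hc, ← norm_rot120 (rot120 P - P - a - b), ← norm_rot120 (rot120 _)]; congr 1; abel
  · rw [← hb, ← norm_rot120 b, ← norm_rot120 (rot120 b)]; congr 1
    simp only [rot120_sub, rot120_neg, rot120_rot120]; abel
  · rw [← ha, ← norm_rot120 a, ← norm_rot120 (rot120 a)]; congr 1; abel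
  · rw [← hb, ← norm_rot120 b, ← norm_rot120 (rot120 b), ← norm_neg (rot120 (rot120 b))]
    congr 1; simp only [rot120_rot120]; abel
  · rw [← hc, ← norm_neg (rot120 P - P - a - b)]
    congr 1; rw [rot120_rot120 (rot120 P - P - a - b)]; abel
  · rw [← ha, ← norm_rot120 a, ← norm_neg (rot120 a)]; congr 1; simp only [rot120_rot120]; abel

theorem norm_half_add_smul_rot90 {w : Plane} (h0 : w ≠ 0) (h2 : ‖w‖ ≤ 2) {ε : ℝ}
    (hε : ε ^ 2 = 1) :
    ‖(1 / 2 : ℝ) • w + (ε * √(1 / ‖w‖ ^ 2 - 1 / 4)) • rot90 w‖ = 1 := by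
  have hpos : 0 < ‖w‖ := norm_pos_iff.mpr h0
  have hr : 0 ≤ 1 / ‖w‖ ^ 2 - 1 / 4 := by
    rw [sub_nonneg]
    apply one_div_le_one_div_of_le (by positivity)
    nlinarith
  rw [← sq_eq_sq₀ (norm_nonneg _) zero_le_one, norm_sq_smul_add_smul_rot90, mul_pow, hε,
    Real.sq_sqrt hr]
  field_simp
  ring

theorem exists_path_unit_vectors_add_eq {E : Plane} (h1 : 1 < ‖E‖) (h3 : ‖E‖ < 3) :
    ∃ a b c : unitInterval → Plane, Continuous a ∧ Continuous b ∧ Continuous c ∧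
      (∃ s t, a s ≠ a t) ∧
      ∀ t, ‖a t‖ = 1 ∧ ‖b t‖ = 1 ∧ ‖c t‖ = 1 ∧ a t + b t + c t = E := by
  have hE : 0 < ‖E‖ := one_pos.trans h1
  let u : ℝ → Plane := fun θ =>
    (Real.cos θ / ‖E‖) • E + (Real.sin θ / ‖E‖) • rot90 E
  have hu : Continuous u := by fun_prop
  have hu1 (θ : ℝ) : ‖u θ‖ = 1 := by
    rw [← sq_eq_sq₀ (norm_nonneg _) zero_le_one, norm_sq_smul_add_smul_rot90]
    field_simp
    simp
  have hEu (θ : ℝ) : ‖E - u θ‖ ^ 2 = ‖E‖ ^ 2 + 1 - 2 * ‖E‖ * Real.cos θ := by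
    have : E - u θ = (1 - Real.cos θ / ‖E‖) • E + (-Real.sin θ / ‖E‖) • rot90 E := by
      simp only [u]; module
    rw [this, norm_sq_smul_add_smul_rot90]
    field_simp
    linear_combination Real.sin_sq_add_cos_sq θ
  have hne (θ : ℝ) : E - u θ ≠ 0 := by
    intro h
    have := hu1 θ
    rw [← sub_eq_zero.mp h] at this
    exact h1.ne' this
  have hlt : ‖E - u 0‖ < 2 := by
    apply lt_of_pow_lt_pow_left₀ 2 zero_le_two
    rw [hEu, Real.cos_zero]
    nlinarith
  obtain ⟨δ, hδ, hball⟩ := Metric.eventually_nhds_iff.mp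
    ((show Continuous fun θ => ‖E - u θ‖ by fun_prop).continuousAt.eventually_lt
      continuousAt_const hlt)
  let η : ℝ := min (δ / 2) 1
  have hη : 0 < η := by positivity
  have hle (t : unitInterval) : ‖E - u (t * η)‖ ≤ 2 := by
    refine (hball ?_).le
    have ht := t.2
    rw [dist_zero_right, Real.norm_of_nonneg (mul_nonneg ht.1 hη.le)]
    calc (t : ℝ) * η ≤ 1 * η := by gcongr; exact ht.2
      _ ≤ δ / 2 := by rw [one_mul]; exact min_le_left _ _
      _ < δ := half_lt_self hδ
  let f (ε : ℝ) (w : Plane) : Plane :=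
    (1 / 2 : ℝ) • w + (ε * √(1 / ‖w‖ ^ 2 - 1 / 4)) • rot90 w
  have hf (ε : ℝ) : Continuous fun t : unitInterval => f ε (E - u (t * η)) := by
    have hinv : Continuous fun t : unitInterval => 1 / ‖E - u (t * η)‖ ^ 2 :=
      continuous_const.div (by fun_prop) fun t => pow_ne_zero 2 (norm_ne_zero_iff.mpr (hne _))
    exact Continuous.add (by fun_prop)
      ((continuous_const.mul (hinv.sub continuous_const).sqrt).smul (by fun_prop))
  refine ⟨fun t => u (t * η), fun t => f 1 (E - u (t * η)), fun t => f (-1) (E - u (t * η)),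
    by fun_prop, hf 1, hf (-1), ⟨0, 1, fun h => ?_⟩, fun t => ⟨hu1 _, ?_, ?_, ?_⟩⟩
  · have hcos : Real.cos 0 = Real.cos η := by
      have h0 := hEu 0
      have hη' := hEu η
      simp only [Set.Icc.coe_zero, Set.Icc.coe_one, zero_mul, one_mul] at h
      rw [h, hη'] at h0
      exact mul_left_cancel₀ (mul_pos two_pos hE).ne' (by linarith)
    refine (Real.cos_lt_cos_of_nonneg_of_le_pi le_rfl ?_ hη).ne' hcos
    exact (min_le_right _ _).trans (by linarith [Real.pi_gt_three])
  · exact norm_half_add_smul_rot90 (hne _) (hle t) (by norm_num)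
  · exact norm_half_add_smul_rot90 (hne _) (hle t) (by norm_num)
  · simp only [f]; module

theorem not_countable_of_path {X : Type*} [MetricSpace X] {S : Set X} {x : unitInterval → X}
    (hx : Continuous x) (hS : ∀ t, x t ∈ S) {s t : unitInterval} (hst : x s ≠ x t) :
    ¬ S.Countable := fun hc =>
  hst (hc.isTotallyDisconnected (Set.range x) (Set.range_subset_iff.mpr hS)
    (isPreconnected_range hx) ⟨s, rfl⟩ ⟨t, rfl⟩)

/-- If `1 < ‖R P − P‖ < 3` then the trihex with pinned equilateral triangle
`P, R P, R²P` and all twelve bars of unit length is flexible: there is a nonconstant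
continuous path of realizations; in particular it has uncountably many realizations. -/
theorem trihex_equilateral_is_flexible
    (P : Plane) (h1 : 1 < ‖rot120 P - P‖) (h3 : ‖rot120 P - P‖ < 3) :
    (∃ x : unitInterval → Fin 6 → Plane,
      Continuous x ∧ (∃ s t : unitInterval, x s ≠ x t) ∧
      ∀ t : unitInterval, TrihexRealization P (x t)) ∧
    ¬ {y : Fin 6 → Plane | TrihexRealization P y}.Countable := by
  obtain ⟨a, b, c, ha, hb, hc, ⟨s, t, hst⟩, h⟩ := exists_path_unit_vectors_add_eq h1 h3
  have hcont : Continuous fun t => trihexOfVectors P (a t) (b t) (c t) := by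
    refine continuous_pi fun i => ?_
    fin_cases i <;> simp [trihexOfVectors] <;> fun_prop
  have hne : trihexOfVectors P (a s) (b s) (c s) ≠ trihexOfVectors P (a t) (b t) (c t) :=
    fun h => hst (add_left_cancel (congrFun h 0))
  have hreal (t) : TrihexRealization P (trihexOfVectors P (a t) (b t) (c t)) :=
    trihexRealization_trihexOfVectors (h t).1 (h t).2.1 (h t).2.2.1 (h t).2.2.2
  exact ⟨⟨_, hcont, ⟨s, t, hne⟩, hreal⟩, not_countable_of_path hcont hreal hne⟩
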